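/- Let p and ℓ be prime numbers, let λ be a natural number, and let f : ℍ → ℂ satisfy the weight-λ transformation law for Γ₀(p). Let γ₀ = [[a,b],[c,d]] ∈ SL₂(ℤ) be a matrix with p ∣ c and ℓ ∣ d. Then for every τ ∈ ℍ one has f(γ₀•τ)·f(τ/ℓ) = ℓ^λ·f(τ)·f(ℓ·(γ₀•τ)); that is, f(γ₀•τ)/f(ℓ·(γ₀•τ)) = ℓ^λ·f(τ)/f(τ/ℓ) wherever the denominators are nonzero. -/

import Mathlib

open UpperHalfPlane Matrix MatrixGroups

/-- Scaling a point of the upper half-plane by a positive natural number `ℓ`: `τ ↦ ℓτ`. -/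
noncomputable def UpperHalfPlane.natScale (ℓ : ℕ) (hℓ : 0 < ℓ) (τ : ℍ) : ℍ :=
  ⟨(ℓ : ℂ) * (τ : ℂ), by
    have h : ((ℓ : ℂ) * (τ : ℂ)).im = (ℓ : ℝ) * (τ : ℂ).im := by
      simp [Complex.mul_im]
    rw [h]
    exact mul_pos (by exact_mod_cast hℓ) τ.2⟩

/-- Dividing a point of the upper half-plane by a positive natural number `ℓ`: `τ ↦ τ/ℓ`. -/
noncomputable def UpperHalfPlane.natDiv (ℓ : ℕ) (hℓ : 0 < ℓ) (τ : ℍ) : ℍ :=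
  ⟨(τ : ℂ) / (ℓ : ℂ), by
    have h : ((τ : ℂ) / (ℓ : ℂ)) = (τ : ℂ) / ((ℓ : ℝ) : ℂ) := by norm_cast
    rw [h, Complex.div_ofReal_im]
    exact div_pos τ.2 (by exact_mod_cast hℓ)⟩

/-- `f : ℍ → ℂ` satisfies the weight-`λ` transformation law for `Γ₀(M)`:
`f(γ•τ) = (cτ+d)^λ · f(τ)` for all `γ = [[a,b],[c,d]] ∈ Γ₀(M)`. -/
def SatisfiesWeightLaw (M : ℕ) (lam : ℕ) (f : ℍ → ℂ) : Prop :=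
  ∀ γ ∈ CongruenceSubgroup.Gamma0 M, ∀ τ : ℍ,
    f (γ • τ) = ((γ 1 0 : ℂ) * (τ : ℂ) + (γ 1 1 : ℂ)) ^ lam * f τ

/-- If `d = ℓe`, then `ℓ·(γ•τ) = δ•(τ/ℓ)` for `γ = [[a,b],[c,d]]` and `δ = [[aℓ,b],[c,e]]`. -/
theorem UpperHalfPlane.natScale_smul_eq_smul_natDiv (ℓ : ℕ) (hℓ : 0 < ℓ) (γ δ : SL(2, ℤ))
    (h00 : δ 0 0 = γ 0 0 * ℓ) (h01 : δ 0 1 = γ 0 1) (h10 : δ 1 0 = γ 1 0)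
    (h11 : γ 1 1 = ℓ * δ 1 1) (τ : ℍ) :
    natScale ℓ hℓ (γ • τ) = δ • natDiv ℓ hℓ τ := by
  have hℓ0 : (ℓ : ℂ) ≠ 0 := by exact_mod_cast hℓ.ne'
  apply UpperHalfPlane.ext
  change (ℓ : ℂ) * ((γ • τ : ℍ) : ℂ) = _
  have hw : ((natDiv ℓ hℓ τ : ℍ) : ℂ) = (τ : ℂ) / ℓ := rfl
  rw [coe_specialLinearGroup_apply, coe_specialLinearGroup_apply, hw, h00, h01, h10, h11]
  simp only [algebraMap_int_eq, eq_intCast, Int.cast_mul, Int.cast_natCast, Complex.ofReal_mul,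
    Complex.ofReal_intCast, Complex.ofReal_natCast]
  have hden : (γ 1 0 : ℂ) * τ + ℓ * δ 1 1 = ℓ * (γ 1 0 * (τ / ℓ) + δ 1 1) := by
    field_simp
  rw [hden, mul_assoc _ (ℓ : ℂ) (_ / _), mul_div_cancel₀ _ hℓ0, ← mul_div_assoc,
    mul_div_mul_left _ _ hℓ0]

/-- If `f` satisfies the weight-`λ` transformation law for `Γ₀(p)` and
`γ₀ = [[a,b],[c,d]] ∈ SL₂(ℤ)` with `p ∣ c` and `ℓ ∣ d`, then for all `τ ∈ ℍ`,
`f(γ₀•τ)·f(τ/ℓ) = ℓ^λ·f(τ)·f(ℓ·(γ₀•τ))`. -/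
theorem eisenstein_automorphy_ratio
    (p ℓ : ℕ) (hp : p.Prime) (hℓ : ℓ.Prime) (lam : ℕ)
    (f : ℍ → ℂ) (hf : SatisfiesWeightLaw p lam f)
    (γ₀ : SL(2, ℤ)) (hc : (p : ℤ) ∣ γ₀ 1 0) (hd : (ℓ : ℤ) ∣ γ₀ 1 1) (τ : ℍ) :
    f (γ₀ • τ) * f (UpperHalfPlane.natDiv ℓ hℓ.pos τ)
      = (ℓ : ℂ) ^ lam * f τ * f (UpperHalfPlane.natScale ℓ hℓ.pos (γ₀ • τ)) := by
  obtain ⟨e, he⟩ := hd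
  have hdet : !![γ₀ 0 0 * ℓ, γ₀ 0 1; γ₀ 1 0, e].det = 1 := by
    have h := γ₀.det_coe
    rw [det_fin_two] at h
    rw [det_fin_two_of]
    linear_combination h - γ₀ 0 0 * he
  let δ : SL(2, ℤ) := ⟨_, hdet⟩
  have mem_Gamma0 {γ : SL(2, ℤ)} (h : (p : ℤ) ∣ γ 1 0) : γ ∈ CongruenceSubgroup.Gamma0 p :=
    CongruenceSubgroup.Gamma0_mem.mpr ((ZMod.intCast_zmod_eq_zero_iff_dvd _ _).mpr h)
  have hℓ0 : (ℓ : ℂ) ≠ 0 := by exact_mod_cast hℓ.ne_zero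
  have hfac : (γ₀ 1 0 : ℂ) * τ + γ₀ 1 1 =
      ℓ * ((δ 1 0 : ℂ) * (UpperHalfPlane.natDiv ℓ hℓ.pos τ : ℍ) + δ 1 1) := by
    change _ = (ℓ : ℂ) * ((γ₀ 1 0 : ℂ) * ((τ : ℂ) / ℓ) + e)
    rw [he]
    push_cast
    field_simp
  rw [UpperHalfPlane.natScale_smul_eq_smul_natDiv ℓ hℓ.pos γ₀ δ rfl rfl rfl he,
    hf γ₀ (mem_Gamma0 hc), hf δ (mem_Gamma0 hc), hfac, mul_pow]
  ring
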